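/- arXiv:1606.07594 — 6 statements merged into one kernel-verified Lean document; each statement's English description precedes it below -/
import Mathlib

section
/- Let i, j, k, l ∈ {1,…,n} with i ≠ j, k ≠ l and k ∉ {i,j}. Then: if l ∉ {i,j}, then t_{ij} z_{kl} ~ z_{kl} t_{ij}; if l = i, then t_{ij} z_{kl} ~ z_{kl} t_{kj}; and if l = j, then t_{ij} z_{kl} ~ z_{kl} t_{ik}. -/
namespace PaperFormal

/-- The alphabet `X`: letters `e_r` for `r ∈ {1,…,n}` (modelled as `Fin n`) and
letters `t_{ij} = t_{ji}` for distinct `i,j`, modelled as unordered pairs. -/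
abbrev XA (n : ℕ) := Fin n ⊕ Sym2 (Fin n)

/-- The word consisting of the single letter `e_r`. -/
def E {n : ℕ} (r : Fin n) : FreeMonoid (XA n) := FreeMonoid.of (Sum.inl r)

/-- The word consisting of the single letter `t_{ij} = t_{ji}`. -/
def T {n : ℕ} (i j : Fin n) : FreeMonoid (XA n) := FreeMonoid.of (Sum.inr s(i, j))

/-- The defining relations (R1)–(R10). -/
inductive XRel {n : ℕ} : FreeMonoid (XA n) → FreeMonoid (XA n) → Prop
  | r1 (i : Fin n) : XRel (E i * E i) (E i)
  | r2 (i j : Fin n) (h : i ≠ j) : XRel (E i * E j) (E j * E i)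
  | r3 (i j : Fin n) (h : i ≠ j) : XRel (T i j * T i j) (T i j)
  | r4 (i j k l : Fin n) (hij : i ≠ j) (hkl : k ≠ l) : XRel (T i j * T k l) (T k l * T i j)
  | r5 (i j k : Fin n) (hij : i ≠ j) (hjk : j ≠ k) (hik : i ≠ k) :
      XRel (T i j * T j k) (T j k * T k i)
  | r6 (i j k : Fin n) (hij : i ≠ j) (hki : k ≠ i) (hkj : k ≠ j) :
      XRel (T i j * E k) (E k * T i j)
  | r7 (i j k : Fin n) (hij : i ≠ j) (h : k = i ∨ k = j) : XRel (T i j * E k * T i j) (T i j)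
  | r8 (i j k : Fin n) (hij : i ≠ j) (h : k = i ∨ k = j) : XRel (E k * T i j * E k) (E k)
  | r9 (i j k : Fin n) (hij : i ≠ j) (hjk : j ≠ k) (hik : i ≠ k) :
      XRel (E k * T k i * E i * T i j * E j * T j k * E k)
           (E k * T k j * E j * T j i * E i * T i k * E k)
  | r10 (i j k l : Fin n) (hij : i ≠ j) (hik : i ≠ k) (hil : i ≠ l) (hjk : j ≠ k)
      (hjl : j ≠ l) (hkl : k ≠ l) :
      XRel (E k * T k i * E i * T i j * E j * T j l * E l * T l k * E k)
           (E k * T k l * E l * T l i * E i * T i j * E j * T j k * E k)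

/-- The congruence `~` on the free monoid `X*` generated by relations (R1)–(R10). -/
def xcon (n : ℕ) : Con (FreeMonoid (XA n)) := conGen XRel

/-- The word `z_{ij} = e_i t_{ij} e_j`. -/
def Z {n : ℕ} (i j : Fin n) : FreeMonoid (XA n) := E i * T i j * E j

theorem T_comm {n : ℕ} (i j : Fin n) : T i j = T j i := by
  simp only [T, Sym2.eq_swap]

/-- A defining relation holds as an equality in the quotient monoid. -/
theorem coe_eq_of_rel {n : ℕ} {a b : FreeMonoid (XA n)} (h : XRel a b) :
    (a : (xcon n).Quotient) = b :=
  (Con.eq _).2 (ConGen.Rel.of _ _ h)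

theorem commute_T_E {n : ℕ} {i j k : Fin n} (hij : i ≠ j) (hki : k ≠ i) (hkj : k ≠ j) :
    Commute (T i j : (xcon n).Quotient) (E k : (xcon n).Quotient) :=
  coe_eq_of_rel (.r6 i j k hij hki hkj)

theorem xcon_T_mul_Z_of_disjoint {n : ℕ} {i j k l : Fin n} (hij : i ≠ j) (hkl : k ≠ l)
    (hki : k ≠ i) (hkj : k ≠ j) (hli : l ≠ i) (hlj : l ≠ j) :
    xcon n (T i j * Z k l) (Z k l * T i j) := by
  have h4 : Commute (T i j : (xcon n).Quotient) (T k l : (xcon n).Quotient) :=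
    coe_eq_of_rel (.r4 i j k l hij hkl)
  exact (Con.eq _).1
    (((commute_T_E hij hki hkj).mul_right h4).mul_right (commute_T_E hij hli hlj)).eq

theorem xcon_T_mul_Z_of_left {n : ℕ} {i j k : Fin n} (hij : i ≠ j) (hki : k ≠ i)
    (hkj : k ≠ j) : xcon n (T i j * Z k i) (Z k i * T k j) := by
  have hk := (commute_T_E hij hki hkj).eq
  have hi := (commute_T_E hkj hki.symm hij).eq
  have h5 : (T i j : (xcon n).Quotient) * T k i = T k i * T k j := by
    rw [T_comm i j, T_comm k i]
    exact coe_eq_of_rel (.r5 j i k hij.symm hki.symm hkj.symm)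
  apply (Con.eq _).1
  simp only [Z, Con.coe_mul]
  calc (T i j : (xcon n).Quotient) * (E k * T k i * E i)
      = (T i j * E k) * T k i * E i := by simp only [mul_assoc]
    _ = E k * (T i j * T k i) * E i := by rw [hk]; simp only [mul_assoc]
    _ = E k * T k i * (T k j * E i) := by rw [h5]; simp only [mul_assoc]
    _ = E k * T k i * E i * T k j := by rw [hi]; simp only [mul_assoc]

/-- for `i ≠ j`, `k ≠ l`, `k ∉ {i,j}`:
if `l ∉ {i,j}` then `t_{ij} z_{kl} ~ z_{kl} t_{ij}`; if `l = i` then `t_{ij} z_{kl} ~ z_{kl} t_{kj}`;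
and if `l = j` then `t_{ij} z_{kl} ~ z_{kl} t_{ik}`. -/
theorem stmt4 (n : ℕ) (hn : 2 ≤ n) (i j k l : Fin n) (hij : i ≠ j) (hkl : k ≠ l)
    (hki : k ≠ i) (hkj : k ≠ j) :
    (l ≠ i → l ≠ j → xcon n (T i j * Z k l) (Z k l * T i j)) ∧
    (l = i → xcon n (T i j * Z k l) (Z k l * T k j)) ∧
    (l = j → xcon n (T i j * Z k l) (Z k l * T i k)) := by
  refine ⟨fun hli hlj => xcon_T_mul_Z_of_disjoint hij hkl hki hkj hli hlj, ?_, ?_⟩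
  · rintro rfl
    exact xcon_T_mul_Z_of_left hij hki hkj
  · rintro rfl
    rw [T_comm i l, T_comm i k]
    exact xcon_T_mul_Z_of_left hij.symm hkj hki
end PaperFormal
end

section
/- For all pairwise distinct i, j, k, l ∈ {1,…,n}, the following ~-equivalences hold: (Z1) z_{ij} z_{ji} z_{ij} ~ z_{ij}; (Z2) z_{ij}³ ~ z_{ij}² ~ z_{ji}²; (Z3) z_{ij} z_{kl} ~ z_{kl} z_{ij}; (Z4) z_{ij} z_{ji} ~ z_{ik} z_{ki}; (Z5) z_{ij} z_{ik} ~ z_{jk} z_{ij} ~ z_{ik} z_{jk}; (Z6) z_{ki} z_{ij} z_{jk} ~ z_{kj} z_{ji} z_{ik}; (Z7) z_{ki} z_{ij} z_{jk} z_{kl} ~ z_{kl} z_{li} z_{ij} z_{jl}. -/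
namespace PaperFormal

variable {n : ℕ}

/-- The class of the letter `e_r` in the quotient monoid. -/
def e (r : Fin n) : (xcon n).Quotient := (E r : FreeMonoid (XA n))

/-- The class of the letter `t_{ij}` in the quotient monoid. -/
def t (i j : Fin n) : (xcon n).Quotient := (T i j : FreeMonoid (XA n))

/-- The class of the word `z_{ij}` in the quotient monoid. -/
def z (i j : Fin n) : (xcon n).Quotient := e i * t i j * e j

lemma coe_Z (i j : Fin n) : ((Z i j : FreeMonoid (XA n)) : (xcon n).Quotient) = z i j := rfl

lemma coe_eq_of_XRel {a b : FreeMonoid (XA n)} (h : XRel a b) :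
    (a : (xcon n).Quotient) = b :=
  (Con.eq _).2 (ConGen.Rel.of _ _ h)

lemma t_comm (i j : Fin n) : t i j = t j i := by
  simp only [t, T, Sym2.eq_swap]

lemma e_mul_self (i : Fin n) : e i * e i = e i := coe_eq_of_XRel (.r1 i)

lemma e_mul_e_mul_self (i : Fin n) (x : (xcon n).Quotient) : e i * (e i * x) = e i * x := by
  rw [← mul_assoc, e_mul_self]

lemma e_mul_e_comm (i j : Fin n) : e i * e j = e j * e i := by
  rcases eq_or_ne i j with rfl | h
  · rfl
  · exact coe_eq_of_XRel (.r2 i j h)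

lemma t_mul_t_comm {i j k l : Fin n} (hij : i ≠ j) (hkl : k ≠ l) :
    t i j * t k l = t k l * t i j :=
  coe_eq_of_XRel (.r4 i j k l hij hkl)

lemma t_mul_t_rotate {i j k : Fin n} (hij : i ≠ j) (hjk : j ≠ k) (hik : i ≠ k) :
    t i j * t j k = t j k * t k i :=
  coe_eq_of_XRel (.r5 i j k hij hjk hik)

lemma t_mul_e_comm {i j k : Fin n} (hij : i ≠ j) (hki : k ≠ i) (hkj : k ≠ j) :
    t i j * e k = e k * t i j :=
  coe_eq_of_XRel (.r6 i j k hij hki hkj)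

lemma t_mul_e_mul_t {i j : Fin n} (hij : i ≠ j) : t i j * e j * t i j = t i j :=
  coe_eq_of_XRel (.r7 i j j hij (.inr rfl))

lemma e_mul_t_mul_e_left {i j : Fin n} (hij : i ≠ j) : e i * t i j * e i = e i :=
  coe_eq_of_XRel (.r8 i j i hij (.inl rfl))

lemma e_mul_t_mul_e_right {i j : Fin n} (hij : i ≠ j) : e j * t i j * e j = e j :=
  coe_eq_of_XRel (.r8 i j j hij (.inr rfl))

lemma e_mul_z (i j : Fin n) : e i * z i j = z i j := by
  simp only [z, ← mul_assoc, e_mul_self]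

lemma z_mul_e (i j : Fin n) : z i j * e j = z i j := by
  simp only [z, mul_assoc, e_mul_self]

lemma z_mul_z_swap {i j : Fin n} (hij : i ≠ j) : z i j * z j i = e i := by
  have h := t_mul_e_mul_t hij
  have h' := e_mul_t_mul_e_left hij
  have := e_mul_self j
  have := t_comm i j
  grind [z]

lemma z_mul_self {i j : Fin n} (hij : i ≠ j) : z i j * z i j = e i * e j := by
  calc z i j * z i j = e i * t i j * (e j * e i) * t i j * e j := by simp only [z, mul_assoc]
    _ = (e i * t i j * e i) * (e j * t i j * e j) := by
      rw [e_mul_e_comm j i]; simp only [mul_assoc]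
    _ = e i * e j := by rw [e_mul_t_mul_e_left hij, e_mul_t_mul_e_right hij]

lemma z_mul_z_of_source_eq {i j k : Fin n} (hij : i ≠ j) :
    z i j * z i k = e j * z i k := by
  calc z i j * z i k = e i * t i j * (e j * e i) * t i k * e k := by simp only [z, mul_assoc]
    _ = (e i * t i j * e i) * e j * t i k * e k := by
      rw [e_mul_e_comm j i]; simp only [mul_assoc]
    _ = e j * z i k := by
      rw [e_mul_t_mul_e_left hij, e_mul_e_comm i j]; simp only [z, mul_assoc]

lemma e_commute_z {i j k : Fin n} (hij : i ≠ j) (hki : k ≠ i) (hkj : k ≠ j) :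
    Commute (e k) (z i j) :=
  (Commute.mul_right (e_mul_e_comm k i)
    (t_mul_e_comm hij hki hkj).symm).mul_right (e_mul_e_comm k j)

lemma z_mul_z_of_target_eq {i j k : Fin n} (hij : i ≠ j) (hik : i ≠ k) (hjk : j ≠ k) :
    z i k * z j k = e j * z i k := by
  calc z i k * z j k = e i * t i k * (e k * e j) * t j k * e k := by simp only [z, mul_assoc]
    _ = e i * t i k * e j * (e k * t j k * e k) := by
      rw [e_mul_e_comm k j]; simp only [mul_assoc]
    _ = z i k * e j := by
      rw [e_mul_t_mul_e_right hjk, mul_assoc, e_mul_e_comm j k]; simp only [z, mul_assoc]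
    _ = e j * z i k := (e_commute_z hik hij.symm hjk).eq.symm

lemma z_mul_z_of_target_eq_source {i j k : Fin n} (hij : i ≠ j) (hik : i ≠ k) (hjk : j ≠ k) :
    z j k * z i j = e j * z i k := by
  have ht : t j k * t i j = t i k * t i j := by
    rw [t_mul_t_comm hjk hij, t_mul_t_rotate hij hjk hik, t_comm k i,
      t_mul_t_comm hjk hik, t_comm i k, t_mul_t_comm hik.symm hjk,
      t_mul_t_rotate hjk hik.symm hij.symm]
  calc z j k * z i j = e j * t j k * (e k * e i) * t i j * e j := by simp only [z, mul_assoc]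
    _ = e j * (t j k * e i) * (e k * t i j) * e j := by
      rw [e_mul_e_comm k i]; simp only [mul_assoc]
    _ = (e j * e i) * (t j k * t i j) * (e k * e j) := by
      rw [t_mul_e_comm hjk hij hik, ← t_mul_e_comm hij hik.symm hjk.symm]
      simp only [mul_assoc]
    _ = e i * (e j * t i k) * t i j * (e j * e k) := by
      rw [ht, e_mul_e_comm k j, e_mul_e_comm j i]; simp only [mul_assoc]
    _ = e i * t i k * (e j * t i j * e j) * e k := by
      rw [← t_mul_e_comm hik hij.symm hjk]; simp only [mul_assoc]
    _ = z i k * e j := by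
      rw [e_mul_t_mul_e_right hij, mul_assoc, e_mul_e_comm j k]; simp only [z, mul_assoc]
    _ = e j * z i k := (e_commute_z hik hij.symm hjk).eq.symm

lemma z_mul_z_comm {i j k l : Fin n} (hij : i ≠ j) (hik : i ≠ k) (hil : i ≠ l) (hjk : j ≠ k)
    (hjl : j ≠ l) (hkl : k ≠ l) : z i j * z k l = z k l * z i j :=
  ((e_commute_z hkl hik hil).mul_left
    ((Commute.mul_right (t_mul_e_comm hij hik.symm hjk.symm) (t_mul_t_comm hij hkl)).mul_right
      (t_mul_e_comm hij hil.symm hjl.symm))).mul_left (e_commute_z hkl hjk hjl)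

lemma z_triangle {i j k : Fin n} (hij : i ≠ j) (hik : i ≠ k) (hjk : j ≠ k) :
    z k i * z i j * z j k = z k j * z j i * z i k := by
  have h : e k * t k i * e i * t i j * e j * t j k * e k =
      e k * t k j * e j * t j i * e i * t i k * e k :=
    coe_eq_of_XRel (.r9 i j k hij hjk hik)
  simpa only [z, mul_assoc, e_mul_e_mul_self] using h

lemma z_quadrilateral {i j k l : Fin n} (hij : i ≠ j) (hik : i ≠ k) (hil : i ≠ l) (hjk : j ≠ k)
    (hjl : j ≠ l) (hkl : k ≠ l) :
    z k i * z i j * z j l * z l k = z k l * z l i * z i j * z j k := by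
  have h : e k * t k i * e i * t i j * e j * t j l * e l * t l k * e k =
      e k * t k l * e l * t l i * e i * t i j * e j * t j k * e k :=
    coe_eq_of_XRel (.r10 i j k l hij hik hil hjk hjl hkl)
  simpa only [z, mul_assoc, e_mul_e_mul_self] using h

lemma z_triangle_mul_z {i j k l : Fin n} (hij : i ≠ j) (hik : i ≠ k) (hil : i ≠ l) (hjk : j ≠ k)
    (hjl : j ≠ l) (hkl : k ≠ l) :
    z k i * z i j * z j k * z k l = z k l * z l i * z i j * z j l := by
  symm
  calc z k l * z l i * z i j * z j l
      = (z k l * z l i * z i j * z j k) * z k j * z j l := by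
        rw [mul_assoc _ (z j k), z_mul_z_swap hjk, mul_assoc _ (e j), e_mul_z]
    _ = z k i * z i j * (z j l * z l k * z k j) * z j l := by
        rw [← z_quadrilateral hij hik hil hjk hjl hkl]; simp only [mul_assoc]
    _ = z k i * z i j * z j k * (z k l * (z l j * z j l)) := by
        rw [z_triangle hkl.symm hjl.symm hjk.symm]; simp only [mul_assoc]
    _ = z k i * z i j * z j k * z k l := by rw [z_mul_z_swap hjl.symm, z_mul_e]

/-- relations (Z1)–(Z7): for pairwise distinct `i, j, k, l`. -/
theorem stmt5 (n : ℕ) (hn : 2 ≤ n) (i j k l : Fin n) (hij : i ≠ j) (hik : i ≠ k)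
    (hil : i ≠ l) (hjk : j ≠ k) (hjl : j ≠ l) (hkl : k ≠ l) :
    -- (Z1)
    xcon n (Z i j * Z j i * Z i j) (Z i j) ∧
    -- (Z2)
    (xcon n (Z i j * Z i j * Z i j) (Z i j * Z i j) ∧
      xcon n (Z i j * Z i j) (Z j i * Z j i)) ∧
    -- (Z3)
    xcon n (Z i j * Z k l) (Z k l * Z i j) ∧
    -- (Z4)
    xcon n (Z i j * Z j i) (Z i k * Z k i) ∧
    -- (Z5)
    (xcon n (Z i j * Z i k) (Z j k * Z i j) ∧ xcon n (Z j k * Z i j) (Z i k * Z j k)) ∧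
    -- (Z6)
    xcon n (Z k i * Z i j * Z j k) (Z k j * Z j i * Z i k) ∧
    -- (Z7)
    xcon n (Z k i * Z i j * Z j k * Z k l) (Z k l * Z l i * Z i j * Z j l) := by
  simp only [← Con.eq, Con.coe_mul, coe_Z]
  refine ⟨?_, ⟨?_, ?_⟩, z_mul_z_comm hij hik hil hjk hjl hkl, ?_, ⟨?_, ?_⟩,
    z_triangle hij hik hjk, z_triangle_mul_z hij hik hil hjk hjl hkl⟩
  · rw [z_mul_z_swap hij, e_mul_z]
  · rw [z_mul_self hij, e_mul_e_comm, mul_assoc, e_mul_z, z, ← mul_assoc, ← mul_assoc,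
      e_mul_e_comm j i, mul_assoc (e i), mul_assoc (e i), e_mul_t_mul_e_right hij,
      e_mul_e_comm]
  · rw [z_mul_self hij, z_mul_self hij.symm, e_mul_e_comm]
  · rw [z_mul_z_swap hij, z_mul_z_swap hik]
  · rw [z_mul_z_of_source_eq hij, z_mul_z_of_target_eq_source hij hik hjk]
  · rw [z_mul_z_of_target_eq hij hik hjk, z_mul_z_of_target_eq_source hij hik hjk]
end PaperFormal
end

section
/- Let u = t_{i₁j₁}⋯t_{i_sj_s} and v = t_{k₁l₁}⋯t_{k_tl_t} be words over the letters t_{ij} only (possibly empty). If the equivalence relation on {1,…,n} generated by the pairs (i₁,j₁),…,(i_s,j_s) equals the equivalence relation generated by the pairs (k₁,l₁),…,(k_t,l_t), then u ~ v. -/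
namespace PaperFormal

/-- The partial bijection `f̄_{ij}`: domain `{1,…,n}∖{i}`, maps `j` to `i`, fixes other points. -/
def fbar {n : ℕ} (i j : Fin n) (x : Fin n) : Option (Fin n) :=
  if x = i then none else if x = j then some i else some x

/-- The composite partial bijection `ū` associated to `u = z_{i₁j₁}⋯z_{i_sj_s}`
(applying `f̄_{i₁j₁}` first). -/
def pcomp {n : ℕ} (L : List (Fin n × Fin n)) (x : Fin n) : Option (Fin n) :=
  L.foldl (fun o p => o.bind (fbar p.1 p.2)) (some x)

/-- The word `z_{i₁j₁}⋯z_{i_sj_s}`. -/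
def zprod {n : ℕ} (L : List (Fin n × Fin n)) : FreeMonoid (XA n) :=
  (L.map fun p => Z p.1 p.2).prod

/-- The word `t_{i₁j₁}⋯t_{i_sj_s}`. -/
def tprod {n : ℕ} (L : List (Fin n × Fin n)) : FreeMonoid (XA n) :=
  (L.map fun p => T p.1 p.2).prod

/-- The class of the letter `t_{ij}` in the quotient of `X*` by `~`. -/
def tclass {n : ℕ} (i j : Fin n) : (xcon n).Quotient := (T i j : FreeMonoid (XA n))

/-- The class of the word `t_{i₁j₁}⋯t_{i_sj_s}` in the quotient of `X*` by `~`. -/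
def tprodClass {n : ℕ} (L : List (Fin n × Fin n)) : (xcon n).Quotient :=
  (tprod L : FreeMonoid (XA n))

theorem coe_eq_coe_of_xRel {n : ℕ} {u v : FreeMonoid (XA n)} (h : XRel u v) :
    (u : (xcon n).Quotient) = v :=
  (Con.eq _).2 (ConGen.Rel.of _ _ h)

theorem tclass_swap {n : ℕ} (i j : Fin n) : tclass i j = tclass j i := by
  simp only [tclass, T, Sym2.eq_swap]

theorem tclass_mul_self {n : ℕ} {i j : Fin n} (h : i ≠ j) :
    tclass i j * tclass i j = tclass i j :=
  coe_eq_coe_of_xRel (.r3 i j h)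

theorem commute_tclass {n : ℕ} {i j k l : Fin n} (hij : i ≠ j) (hkl : k ≠ l) :
    Commute (tclass i j) (tclass k l) :=
  coe_eq_coe_of_xRel (.r4 i j k l hij hkl)

theorem tclass_mul_tclass {n : ℕ} {i j k : Fin n} (hij : i ≠ j) (hjk : j ≠ k) (hik : i ≠ k) :
    tclass i j * tclass j k = tclass j k * tclass k i :=
  coe_eq_coe_of_xRel (.r5 i j k hij hjk hik)

theorem tprodClass_nil {n : ℕ} : tprodClass ([] : List (Fin n × Fin n)) = 1 := rfl

theorem tprodClass_cons {n : ℕ} (p : Fin n × Fin n) (L : List (Fin n × Fin n)) :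
    tprodClass (p :: L) = tclass p.1 p.2 * tprodClass L := by
  simp only [tprodClass, tprod, tclass, List.map_cons, List.prod_cons, Con.coe_mul]

theorem commute_tprodClass {n : ℕ} {L : List (Fin n × Fin n)} (hL : ∀ p ∈ L, p.1 ≠ p.2)
    {x : (xcon n).Quotient} (hx : ∀ i j, i ≠ j → Commute (tclass i j) x) :
    Commute (tprodClass L) x := by
  induction L with
  | nil => exact Commute.one_left x
  | cons p L ih =>
    rw [List.forall_mem_cons] at hL
    rw [tprodClass_cons]
    exact (hx _ _ hL.1).mul_left (ih hL.2)

theorem commute_tclass_tprodClass {n : ℕ} {L : List (Fin n × Fin n)}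
    (hL : ∀ p ∈ L, p.1 ≠ p.2) {i j : Fin n} (h : i ≠ j) :
    Commute (tclass i j) (tprodClass L) :=
  (commute_tprodClass hL fun _ _ h' => commute_tclass h' h).symm

theorem tprodClass_mul_tclass_of_mem {n : ℕ} {L : List (Fin n × Fin n)}
    (hL : ∀ p ∈ L, p.1 ≠ p.2) {a b : Fin n} (h : (a, b) ∈ L) :
    tprodClass L * tclass a b = tprodClass L := by
  induction L with
  | nil => simp at h
  | cons p L ih =>
    have hab : a ≠ b := hL _ h
    rw [List.forall_mem_cons] at hL
    rw [tprodClass_cons, mul_assoc]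
    rcases List.mem_cons.1 h with rfl | h
    · rw [← (commute_tclass_tprodClass hL.2 hab).eq, ← mul_assoc, tclass_mul_self hab]
    · rw [ih hL.2 h]

/-- A word in the letters `t` absorbs every `t_{ab}` whose indices are identified by the
equivalence relation generated by its index pairs. -/
theorem tprodClass_mul_tclass_of_eqvGen {n : ℕ} {L : List (Fin n × Fin n)}
    (hL : ∀ p ∈ L, p.1 ≠ p.2) {a b : Fin n}
    (h : Relation.EqvGen (fun a b => (a, b) ∈ L) a b) (hab : a ≠ b) :
    tprodClass L * tclass a b = tprodClass L := by
  induction h with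
  | rel a b h => exact tprodClass_mul_tclass_of_mem hL h
  | refl a => exact absurd rfl hab
  | symm a b _ ih => rw [tclass_swap, ih hab.symm]
  | trans a b c _ _ ihab ihbc =>
    by_cases h₁ : a = b
    · subst h₁; exact ihbc hab
    by_cases h₂ : b = c
    · subst h₂; exact ihab hab
    have key : tclass a b * tclass b c * tclass a c = tclass a b * tclass b c := by
      rw [tclass_mul_tclass h₁ h₂ hab, tclass_swap a c, mul_assoc, tclass_mul_self hab.symm]
    calc tprodClass L * tclass a c
        = tprodClass L * (tclass a b * tclass b c * tclass a c) := by
          rw [← mul_assoc, ← mul_assoc, ihab h₁, ihbc h₂]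
      _ = tprodClass L := by rw [key, ← mul_assoc, ihab h₁, ihbc h₂]

theorem tprodClass_mul_tprodClass {n : ℕ} {L M : List (Fin n × Fin n)}
    (hL : ∀ p ∈ L, p.1 ≠ p.2) (hM : ∀ p ∈ M, p.1 ≠ p.2)
    (h : ∀ p ∈ M, Relation.EqvGen (fun a b => (a, b) ∈ L) p.1 p.2) :
    tprodClass L * tprodClass M = tprodClass L := by
  induction M with
  | nil => rw [tprodClass_nil, mul_one]
  | cons p M ih =>
    rw [List.forall_mem_cons] at hM h
    rw [tprodClass_cons, ← mul_assoc, tprodClass_mul_tclass_of_eqvGen hL h.1 hM.1, ih hM.2 h.2]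

/-- Lemma T: if two words `u = t_{i₁j₁}⋯t_{i_sj_s}` and
`v = t_{k₁l₁}⋯t_{k_tl_t}` over the letters `t` (possibly empty) are such that the equivalence
relations generated by their lists of index pairs coincide, then `u ~ v`. -/
theorem stmt8 (n : ℕ) (hn : 2 ≤ n) (L M : List (Fin n × Fin n))
    (hLd : ∀ p ∈ L, p.1 ≠ p.2) (hMd : ∀ p ∈ M, p.1 ≠ p.2)
    (h : Relation.EqvGen (fun a b => (a, b) ∈ L) = Relation.EqvGen (fun a b => (a, b) ∈ M)) :
    xcon n (tprod L) (tprod M) := by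
  have hLM : tprodClass L * tprodClass M = tprodClass L :=
    tprodClass_mul_tprodClass hLd hMd fun p hp => h ▸ Relation.EqvGen.rel p.1 p.2 hp
  have hML : tprodClass M * tprodClass L = tprodClass M :=
    tprodClass_mul_tprodClass hMd hLd fun p hp => h ▸ Relation.EqvGen.rel p.1 p.2 hp
  have hcomm : Commute (tprodClass L) (tprodClass M) :=
    commute_tprodClass hLd fun _ _ hij => commute_tclass_tprodClass hMd hij
  exact (Con.eq _).1 (hLM.symm.trans (hcomm.eq.trans hML))
end PaperFormal
end

section
/- Every nonempty word w over the alphabet X is ~-equivalent to a product w₁ w₂ w₃, where w₁ and w₃ are (possibly empty) words over the letters t_{ij} only, and w₂ is a nonempty product of words of the form z_{ij}. -/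
namespace PaperFormal

/-- The class of the letter `e_i`. -/
def cE {n : ℕ} (i : Fin n) : (xcon n).Quotient := (E i : FreeMonoid (XA n))

/-- The class of the letter `t_{ij}`. -/
def cT {n : ℕ} (i j : Fin n) : (xcon n).Quotient := (T i j : FreeMonoid (XA n))

/-- The subsemigroup generated by the classes of the words `z_{ij}`. -/
def zSub (n : ℕ) : Subsemigroup (xcon n).Quotient :=
  Subsemigroup.closure {x | ∃ i j, i ≠ j ∧ x = cE i * cT i j * cE j}

/-- The submonoid generated by the classes of the letters `t_{ij}`. -/
def tSub (n : ℕ) : Submonoid (xcon n).Quotient :=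
  Submonoid.closure {x | ∃ i j, i ≠ j ∧ x = cT i j}

section Relations

variable {n : ℕ}

theorem coe_eq_of_xRel {u v : FreeMonoid (XA n)} (h : XRel u v) :
    (u : (xcon n).Quotient) = v :=
  (Con.eq _).2 (ConGen.Rel.of _ _ h)

theorem cT_comm (i j : Fin n) : cT i j = cT j i := by
  simp [cT, T, Sym2.eq_swap]

theorem cE_mul_self (i : Fin n) : cE i * cE i = cE i :=
  coe_eq_of_xRel (.r1 i)

theorem cE_mul_cE (i j : Fin n) : cE i * cE j = cE j * cE i := by
  obtain rfl | h := eq_or_ne i j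
  · rfl
  · exact coe_eq_of_xRel (.r2 i j h)

theorem cT_mul_self {i j : Fin n} (h : i ≠ j) : cT i j * cT i j = cT i j :=
  coe_eq_of_xRel (.r3 i j h)

theorem cT_mul_cT {i j k l : Fin n} (hij : i ≠ j) (hkl : k ≠ l) :
    cT i j * cT k l = cT k l * cT i j :=
  coe_eq_of_xRel (.r4 i j k l hij hkl)

theorem cT_mul_cT_rotate {i j k : Fin n} (hij : i ≠ j) (hjk : j ≠ k) (hik : i ≠ k) :
    cT i j * cT j k = cT j k * cT k i :=
  coe_eq_of_xRel (.r5 i j k hij hjk hik)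

theorem cT_mul_cE {i j k : Fin n} (hij : i ≠ j) (hki : k ≠ i) (hkj : k ≠ j) :
    cT i j * cE k = cE k * cT i j :=
  coe_eq_of_xRel (.r6 i j k hij hki hkj)

theorem cT_mul_cE_mul_cT {i j : Fin n} (hij : i ≠ j) : cT i j * cE i * cT i j = cT i j :=
  coe_eq_of_xRel (.r7 i j i hij (.inl rfl))

theorem cE_mul_cT_mul_cE {i j : Fin n} (hij : i ≠ j) : cE i * cT i j * cE i = cE i :=
  coe_eq_of_xRel (.r8 i j i hij (.inl rfl))

theorem z_mem_zSub {i j : Fin n} (h : i ≠ j) : cE i * cT i j * cE j ∈ zSub n :=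
  Subsemigroup.subset_closure ⟨i, j, h, rfl⟩

theorem cT_mem_tSub {i j : Fin n} (h : i ≠ j) : cT i j ∈ tSub n :=
  Submonoid.subset_closure ⟨i, j, h, rfl⟩

theorem cE_mem_zSub [Nontrivial (Fin n)] (i : Fin n) : cE i ∈ zSub n := by
  obtain ⟨j, hj⟩ := exists_ne i
  have h : cE i = cE i * cT i j * cE j * (cE j * cT j i * cE i) := by
    have h1 := cE_mul_cT_mul_cE hj.symm
    have h2 := cT_mul_cE_mul_cT hj
    have h3 := cE_mul_self j
    rw [cT_comm j i] at *
    grind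
  rw [h]
  exact mul_mem (z_mem_zSub hj.symm) (z_mem_zSub hj)

/-- A factor `e_c t_{cd}` moves to the right through `z_{ab}`, or is absorbed. -/
theorem cE_mul_cT_mul_z [Nontrivial (Fin n)] {a b c d : Fin n} (hab : a ≠ b) (hcd : c ≠ d) :
    cE c * cT c d * (cE a * cT a b * cE b) ∈ zSub n ∨
      ∃ y ∈ zSub n, ∃ i j, i ≠ j ∧
        cE c * cT c d * (cE a * cT a b * cE b) = y * (cE i * cT i j) := by
  by_cases hac : a = c
  · subst hac
    left
    have h1 := cE_mul_cT_mul_cE hcd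
    have h : cE a * cT a d * (cE a * cT a b * cE b) = cE a * cT a b * cE b := by grind
    rw [h]
    exact z_mem_zSub hab
  by_cases had : a = d
  · subst had
    left
    have h1 := cE_mul_self a
    have h : cE c * cT c a * (cE a * cT a b * cE b) =
      cE c * cT c a * cE a * (cE a * cT a b * cE b) := by grind
    rw [h]
    exact mul_mem (z_mem_zSub hcd) (z_mem_zSub hab)
  right
  have h1 : Commute (cT c d) (cE a) := cT_mul_cE hcd hac had
  have h2 : Commute (cE a) (cE c) := cE_mul_cE a c
  by_cases hbc : b = c
  · subst hbc
    refine ⟨cE b, cE_mem_zSub b, a, d, had, ?_⟩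
    have h3 : cT b d * cT a b = cT a b * cT a d := by
      rw [cT_comm b d, cT_comm a b, cT_mul_cT_rotate hcd.symm hab.symm (Ne.symm had)]
    have h4 := cT_mul_cE had hab.symm hcd
    have h5 := cE_mul_cT_mul_cE hab.symm
    rw [cT_comm b a] at h5
    calc cE b * cT b d * (cE a * cT a b * cE b)
        = cE b * (cT b d * cE a) * cT a b * cE b := by simp only [mul_assoc]
      _ = cE b * cE a * (cT b d * cT a b) * cE b := by rw [h1.eq]; simp only [mul_assoc]
      _ = cE b * cE a * cT a b * (cT a d * cE b) := by rw [h3]; simp only [mul_assoc]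
      _ = cE a * (cE b * cT a b * cE b) * cT a d := by rw [h4, ← h2.eq]; simp only [mul_assoc]
      _ = cE b * (cE a * cT a d) := by rw [h5, h2.eq, mul_assoc]
  have h3 : Commute (cE b) (cE c) := cE_mul_cE b c
  by_cases hbd : b = d
  · subst hbd
    refine ⟨_, z_mem_zSub hab, c, a, Ne.symm hac, ?_⟩
    have h4 : cT c b * cT a b = cT a b * cT c a := by
      rw [cT_comm a b, cT_mul_cT_rotate hcd hab.symm (Ne.symm hac), cT_comm a c]
    have h5 := cT_mul_cE (Ne.symm hac) hbc hab.symm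
    have h6 := cT_mul_cE hab (Ne.symm hac) hcd
    calc cE c * cT c b * (cE a * cT a b * cE b)
        = cE c * (cT c b * cE a) * cT a b * cE b := by simp only [mul_assoc]
      _ = cE c * cE a * (cT c b * cT a b) * cE b := by rw [h1.eq]; simp only [mul_assoc]
      _ = cE c * cE a * cT a b * (cT c a * cE b) := by rw [h4]; simp only [mul_assoc]
      _ = cE a * (cE c * cT a b) * cE b * cT c a := by rw [h5, ← h2.eq]; simp only [mul_assoc]
      _ = cE a * cT a b * (cE c * cE b) * cT c a := by rw [← h6]; simp only [mul_assoc]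
      _ = cE a * cT a b * cE b * (cE c * cT c a) := by rw [← h3.eq]; simp only [mul_assoc]
  · refine ⟨_, z_mem_zSub hab, c, d, hcd, ?_⟩
    have h4 : Commute (cT c d) (cE b) := cT_mul_cE hcd hbc hbd
    have h5 : Commute (cE c) (cT a b) := (cT_mul_cE hab (Ne.symm hac) (Ne.symm hbc)).symm
    have h6 : Commute (cT c d) (cT a b) := cT_mul_cT hcd hab
    have h7 : Commute (cE c) (cE a * cT a b * cE b) := (h2.symm.mul_right h5).mul_right h3.symm
    have h8 : Commute (cT c d) (cE a * cT a b * cE b) := (h1.mul_right h6).mul_right h4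
    exact h7.mul_left h8

theorem cE_mul_cT_mul [Nontrivial (Fin n)] {g : (xcon n).Quotient} (hg : g ∈ zSub n) :
    ∀ c d : Fin n, c ≠ d → cE c * cT c d * g ∈ zSub n ∨
      ∃ y ∈ zSub n, ∃ i j, i ≠ j ∧ cE c * cT c d * g = y * (cE i * cT i j) := by
  induction hg using Subsemigroup.closure_induction with
  | mem x hx =>
    obtain ⟨a, b, hab, rfl⟩ := hx
    exact fun c d hcd => cE_mul_cT_mul_z hab hcd
  | mul x y hx hy ihx ihy =>
    intro c d hcd
    rw [← mul_assoc]
    obtain h | ⟨u, hu, i, j, hij, h⟩ := ihx c d hcd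
    · exact .inl (mul_mem h hy)
    · rw [h, mul_assoc]
      obtain h' | ⟨v, hv, k, l, hkl, h'⟩ := ihy i j hij
      · exact .inl (mul_mem hu h')
      · exact .inr ⟨u * v, mul_mem hu hv, k, l, hkl, by rw [h', mul_assoc]⟩

/-- A factor `t_{ij}` between two products of words `z_{ab}` can be moved to one of the ends. -/
theorem mul_cT_mul [Nontrivial (Fin n)] {f : (xcon n).Quotient} (hf : f ∈ zSub n) :
    ∀ i j : Fin n, i ≠ j → ∀ g ∈ zSub n,
      ∃ x ∈ tSub n, ∃ y ∈ zSub n, ∃ z ∈ tSub n, f * cT i j * g = x * y * z ∧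
        (x = 1 ∨ z = 1 ∧ ∃ k l, k ≠ l ∧ x = cT k l) := by
  induction hf using Subsemigroup.closure_induction with
  | mem f hf =>
    obtain ⟨a, b, hab, rfl⟩ := hf
    have key : ∀ j : Fin n, b ≠ j → ∀ g ∈ zSub n,
        ∃ x ∈ tSub n, ∃ y ∈ zSub n, ∃ z ∈ tSub n,
          cE a * cT a b * cE b * cT b j * g = x * y * z ∧
            (x = 1 ∨ z = 1 ∧ ∃ k l, k ≠ l ∧ x = cT k l) := by
      intro j hbj g hg
      have h1 := cE_mul_self b
      have h2 : cE a * cT a b * cE b * cT b j * g =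
        cE a * cT a b * cE b * (cE b * cT b j * g) := by grind
      rw [h2]
      obtain h | ⟨y, hy, k, l, hkl, h⟩ := cE_mul_cT_mul hg b j hbj
      · exact ⟨1, one_mem _, _, mul_mem (z_mem_zSub hab) h, 1, one_mem _, by simp, .inl rfl⟩
      · refine ⟨1, one_mem _, _, mul_mem (z_mem_zSub hab) (mul_mem hy (cE_mem_zSub k)),
          cT k l, cT_mem_tSub hkl, ?_, .inl rfl⟩
        rw [h]
        simp only [mul_assoc, one_mul]
    have pass : ∀ i j k l : Fin n, k ≠ l →
        cE a * cT a b * cE b * cT i j = cT k l * (cE a * cT a b * cE b) → ∀ g ∈ zSub n,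
        ∃ x ∈ tSub n, ∃ y ∈ zSub n, ∃ z ∈ tSub n,
          cE a * cT a b * cE b * cT i j * g = x * y * z ∧
            (x = 1 ∨ z = 1 ∧ ∃ k l, k ≠ l ∧ x = cT k l) := by
      intro i j k l hkl h g hg
      exact ⟨cT k l, cT_mem_tSub hkl, _, mul_mem (z_mem_zSub hab) hg, 1, one_mem _,
        by rw [h]; simp only [mul_assoc, mul_one], .inr ⟨rfl, k, l, hkl, rfl⟩⟩
    have slide : ∀ j : Fin n, a ≠ j → b ≠ j →
        cE a * cT a b * cE b * cT a j = cT b j * (cE a * cT a b * cE b) := by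
      intro j haj hbj
      have h1 := cT_mul_cE haj hab.symm hbj
      have h2 := cT_mul_cE hbj hab haj
      have h3 : cT a b * cT a j = cT b j * cT a b := by
        rw [cT_comm b j, cT_comm a b, cT_mul_cT_rotate hbj.symm hab.symm haj.symm]
      grind
    intro i j hij
    by_cases hbi : b = i
    · subst hbi
      exact key j hij
    by_cases hbj : b = j
    · subst hbj
      rw [cT_comm i b]
      exact key i hij.symm
    by_cases hai : a = i
    · subst hai
      exact pass _ _ b j hbj (slide j hij hbj)
    by_cases haj : a = j
    · subst haj
      rw [cT_comm i a]
      exact pass _ _ b i hbi (slide i hij.symm hbi)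
    refine pass _ _ i j hij ?_
    have h1 := cT_mul_cE hij hai haj
    have h2 := cT_mul_cE hij hbi hbj
    have h3 := cT_mul_cT hij hab
    grind
  | mul f₁ f₂ hf₁ hf₂ ih₁ ih₂ =>
    intro i j hij g hg
    obtain ⟨x, hx, y, hy, z, hz, h, rfl | ⟨rfl, k, l, hkl, rfl⟩⟩ := ih₂ i j hij g hg
    · refine ⟨1, one_mem _, f₁ * y, mul_mem hf₁ hy, z, hz, ?_, .inl rfl⟩
      simp only [mul_assoc, one_mul] at h ⊢
      rw [h]
    · obtain ⟨x, hx, y', hy', z, hz, h', H⟩ := ih₁ k l hkl y hy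
      refine ⟨x, hx, y', hy', z, hz, ?_, H⟩
      rw [← h']
      simp only [mul_assoc, mul_one] at h ⊢
      rw [h]

/-- In a product `τ e_k`, all but at most one letter of the `t`-word `τ` move past `e_k`. -/
theorem mul_cE_of_mem_tSub {τ : (xcon n).Quotient} (hτ : τ ∈ tSub n) (k : Fin n) :
    ∃ τ' ∈ tSub n, τ * cE k = cE k * τ' ∨ ∃ i, k ≠ i ∧ τ * cE k = cT k i * cE k * τ' := by
  induction hτ using Submonoid.closure_induction_left with
  | one => exact ⟨1, one_mem _, .inl (by simp)⟩
  | mul_left x hx y hy ih =>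
    obtain ⟨a, b, hab, rfl⟩ := hx
    obtain ⟨τ', hτ', ih⟩ := ih
    have key : ∀ b : Fin n, k ≠ b → ∃ σ ∈ tSub n, cT k b * y * cE k = cE k * σ ∨
        ∃ i, k ≠ i ∧ cT k b * y * cE k = cT k i * cE k * σ := by
      intro b hkb
      obtain h | ⟨i, hki, h⟩ := ih
      · exact ⟨τ', hτ', .inr ⟨b, hkb, by grind⟩⟩
      · obtain rfl | hbi := eq_or_ne b i
        · have h1 := cT_mul_self hkb
          exact ⟨τ', hτ', .inr ⟨b, hkb, by grind⟩⟩
        · have h1 : cT k b * cT k i = cT k i * cT i b := by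
            rw [cT_comm k b, cT_mul_cT_rotate (Ne.symm hkb) hki hbi]
          have h2 := cT_mul_cE hbi.symm hki hkb
          refine ⟨_, mul_mem (cT_mem_tSub hbi.symm) hτ', .inr ⟨i, hki, ?_⟩⟩
          calc cT k b * y * cE k
              = cT k b * cT k i * cE k * τ' := by rw [mul_assoc, h]; simp only [mul_assoc]
            _ = cT k i * (cT i b * cE k) * τ' := by rw [h1]; simp only [mul_assoc]
            _ = cT k i * cE k * (cT i b * τ') := by rw [h2]; simp only [mul_assoc]
    by_cases hka : k = a
    · subst hka
      exact key b hab
    by_cases hkb : k = b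
    · subst hkb
      rw [cT_comm a k]
      exact key a hab.symm
    have h1 := cT_mul_cE hab hka hkb
    refine ⟨_, mul_mem (cT_mem_tSub hab) hτ', ?_⟩
    obtain h | ⟨i, hki, h⟩ := ih
    · exact .inl (by grind)
    · have h2 := cT_mul_cT hab hki
      exact .inr ⟨i, hki, by grind⟩

theorem exists_tprod_of_mem_tSub {x : (xcon n).Quotient} (hx : x ∈ tSub n) :
    ∃ L : List (Fin n × Fin n), (∀ p ∈ L, p.1 ≠ p.2) ∧ x = (tprod L : FreeMonoid (XA n)) := by
  induction hx using Submonoid.closure_induction with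
  | mem x hx =>
    obtain ⟨i, j, hij, rfl⟩ := hx
    exact ⟨[(i, j)], by simpa using hij, by simp [tprod, cT]⟩
  | one => exact ⟨[], by simp, by simp [tprod]⟩
  | mul x y _ _ ihx ihy =>
    obtain ⟨L, hL, rfl⟩ := ihx
    obtain ⟨L', hL', rfl⟩ := ihy
    refine ⟨L ++ L', ?_, by simp [tprod]⟩
    simpa only [List.mem_append, or_imp, forall_and] using And.intro hL hL'

theorem exists_zprod_of_mem_zSub {x : (xcon n).Quotient} (hx : x ∈ zSub n) :
    ∃ L : List (Fin n × Fin n), (∀ p ∈ L, p.1 ≠ p.2) ∧ L ≠ [] ∧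
      x = (zprod L : FreeMonoid (XA n)) := by
  induction hx using Subsemigroup.closure_induction with
  | mem x hx =>
    obtain ⟨i, j, hij, rfl⟩ := hx
    exact ⟨[(i, j)], by simpa using hij, by simp, by simp [zprod, Z, cE, cT]⟩
  | mul x y _ _ ihx ihy =>
    obtain ⟨L, hL, hne, rfl⟩ := ihx
    obtain ⟨L', hL', -, rfl⟩ := ihy
    refine ⟨L ++ L', ?_, by simp [hne], by simp [zprod]⟩
    simpa only [List.mem_append, or_imp, forall_and] using And.intro hL hL'

theorem exists_factorization_of_letter [Nontrivial (Fin n)] (a : XA n)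
    (ha : ∀ p : Sym2 (Fin n), Sum.inr p = a → ¬ p.IsDiag) :
    ∃ x ∈ tSub n, ∃ y ∈ zSub n, ∃ z ∈ tSub n,
      ((FreeMonoid.of a : FreeMonoid (XA n)) : (xcon n).Quotient) = x * y * z := by
  obtain k | p := a
  · exact ⟨1, one_mem _, cE k, cE_mem_zSub k, 1, one_mem _, by simp [cE, E]⟩
  · induction p with | _ i j =>
    have hij : i ≠ j := by simpa using ha _ rfl
    refine ⟨_, cT_mem_tSub hij, cE i, cE_mem_zSub i, _, cT_mem_tSub hij, ?_⟩
    rw [cT_mul_cE_mul_cT hij]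
    rfl

theorem exists_factorization_mul_letter [Nontrivial (Fin n)] (a : XA n)
    (ha : ∀ p : Sym2 (Fin n), Sum.inr p = a → ¬ p.IsDiag) {x y z : (xcon n).Quotient}
    (hx : x ∈ tSub n) (hy : y ∈ zSub n) (hz : z ∈ tSub n) :
    ∃ x' ∈ tSub n, ∃ y' ∈ zSub n, ∃ z' ∈ tSub n,
      x * y * z * (FreeMonoid.of a : FreeMonoid (XA n)) = x' * y' * z' := by
  obtain k | p := a
  · change ∃ x' ∈ tSub n, ∃ y' ∈ zSub n, ∃ z' ∈ tSub n, x * y * z * cE k = x' * y' * z'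
    obtain ⟨τ, hτ, h | ⟨i, hki, h⟩⟩ := mul_cE_of_mem_tSub hz k
    · exact ⟨x, hx, y * cE k, mul_mem hy (cE_mem_zSub k), τ, hτ, by grind⟩
    · obtain ⟨u, hu, v, hv, w, hw, h', -⟩ := mul_cT_mul hy k i hki _ (cE_mem_zSub k)
      exact ⟨x * u, mul_mem hx hu, v, hv, w * τ, mul_mem hw hτ, by grind⟩
  · induction p with | _ i j =>
    have hij : i ≠ j := by simpa using ha _ rfl
    exact ⟨x, hx, y, hy, z * cT i j, mul_mem hz (cT_mem_tSub hij), by rw [← mul_assoc]; rfl⟩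

theorem exists_factorization [Nontrivial (Fin n)] (l : List (XA n)) (hl : l ≠ [])
    (hdiag : ∀ p : Sym2 (Fin n), Sum.inr p ∈ l → ¬ p.IsDiag) :
    ∃ x ∈ tSub n, ∃ y ∈ zSub n, ∃ z ∈ tSub n,
      ((FreeMonoid.ofList l : FreeMonoid (XA n)) : (xcon n).Quotient) = x * y * z := by
  induction l using List.reverseRecOn with
  | nil => exact absurd rfl hl
  | append_singleton l a ih =>
    have ha : ∀ p : Sym2 (Fin n), Sum.inr p = a → ¬ p.IsDiag := fun p hp =>
      hdiag p (by simp [hp])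
    obtain rfl | hne := eq_or_ne l []
    · exact exists_factorization_of_letter a ha
    · obtain ⟨x, hx, y, hy, z, hz, h⟩ :=
        ih hne fun p hp => hdiag p (List.mem_append_left _ hp)
      rw [FreeMonoid.ofList_append, Con.coe_mul, h, FreeMonoid.ofList_singleton]
      exact exists_factorization_mul_letter a ha hx hy hz

end Relations

/-- Lemma w123: every nonempty word `w` over the alphabet `X` is
`~`-equivalent to a product `w₁ w₂ w₃` with `w₁, w₃` (possibly empty) words over the letters
`t_{ij}` and `w₂` a nonempty product of words `z_{ij}`.  (The hypothesis `hdiag` says that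
`w` only involves genuine letters `t_{ij}` with `i ≠ j`.) -/
theorem stmt9 (n : ℕ) (hn : 2 ≤ n) (w : FreeMonoid (XA n)) (hw : w ≠ 1)
    (hdiag : ∀ p : Sym2 (Fin n), Sum.inr p ∈ FreeMonoid.toList w → ¬ p.IsDiag) :
    ∃ L₁ L₂ L₃ : List (Fin n × Fin n),
      (∀ p ∈ L₁, p.1 ≠ p.2) ∧ (∀ p ∈ L₂, p.1 ≠ p.2) ∧ (∀ p ∈ L₃, p.1 ≠ p.2) ∧
      L₂ ≠ [] ∧ xcon n w (tprod L₁ * zprod L₂ * tprod L₃) := by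
  have : Nontrivial (Fin n) := Fin.nontrivial_iff_two_le.2 hn
  obtain ⟨x, hx, y, hy, z, hz, h⟩ := exists_factorization (FreeMonoid.toList w) hw hdiag
  obtain ⟨L₁, h₁, rfl⟩ := exists_tprod_of_mem_tSub hx
  obtain ⟨L₂, h₂, hne, rfl⟩ := exists_zprod_of_mem_zSub hy
  obtain ⟨L₃, h₃, rfl⟩ := exists_tprod_of_mem_tSub hz
  exact ⟨L₁, L₂, L₃, h₁, h₂, h₃, hne, (Con.eq _).1 h⟩
end PaperFormal
end

section
/- For all 1 ≤ r ≤ n and 1 ≤ k ≤ n−1, the word s_k ε_r s_k is ≈-equivalent to ε_{σ_k(r)}, where σ_k is the transposition of {1,…,n} interchanging k and k+1. Equivalently: s_k ε_r s_k ≈ ε_{r−1} if k = r−1; s_k ε_r s_k ≈ ε_{r+1} if k = r; and s_k ε_r s_k ≈ ε_r otherwise. -/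
namespace PaperFormal


/-- The alphabet `Y`: letters `s_1,…,s_{n-1}` (the letter `s i` for `i : Fin (n-1)`
represents `s_{i+1}`, i.e. indices are 0-based), `e` and `t`. -/
inductive YA (n : ℕ) : Type where
  | s (i : Fin (n - 1))
  | e
  | t

/-- The one-letter word `s_{i+1}` (0-based index `i`). -/
def S {n : ℕ} (i : Fin (n - 1)) : FreeMonoid (YA n) := FreeMonoid.of (YA.s i)

/-- The one-letter word `e`. -/
def Ew {n : ℕ} : FreeMonoid (YA n) := FreeMonoid.of YA.e

/-- The one-letter word `t`. -/
def Tw {n : ℕ} : FreeMonoid (YA n) := FreeMonoid.of YA.t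

/-- The defining relations (R11)–(R21), with 0-based indexing of the `s i`
(so the paper's `s_1` is `S i` with `i.val = 0`, etc.). -/
inductive YRel {n : ℕ} : FreeMonoid (YA n) → FreeMonoid (YA n) → Prop
  | r11 (i) : YRel (S i * S i) 1
  | r12 (i j : Fin (n - 1)) (h : i.val + 1 < j.val ∨ j.val + 1 < i.val) :
      YRel (S i * S j) (S j * S i)
  | r13 (i j : Fin (n - 1)) (h : i.val + 1 = j.val ∨ j.val + 1 = i.val) :
      YRel (S i * S j * S i) (S j * S i * S j)
  | r14a : YRel (Ew * Ew) Ew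
  | r14b : YRel (Ew * Tw * Ew) Ew
  | r15a : YRel (Tw * Tw) Tw
  | r15b : YRel (Tw * Ew * Tw) Tw
  | r15c (i) (h : i.val = 0) : YRel (Tw * S i) Tw
  | r15d (i) (h : i.val = 0) : YRel (S i * Tw) Tw
  | r16 (i) (h : 1 ≤ i.val) : YRel (Ew * S i) (S i * Ew)
  | r17 (i) (h : 2 ≤ i.val) : YRel (Tw * S i) (S i * Tw)
  | r18a (a) (ha : a.val = 0) : YRel (S a * Ew * S a * Ew) Ew
  | r18b (a) (ha : a.val = 0) : YRel (S a * Ew * S a) (Ew * S a * Ew)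
  | r19 (b) (hb : b.val = 1) : YRel (Tw * S b * Tw * S b) (S b * Tw * S b * Tw)
  | r20 (a b c) (ha : a.val = 0) (hb : b.val = 1) (hc : c.val = 2) :
      YRel (Tw * (S b * S c * S a * S b) * Tw * (S b * S c * S a * S b))
           (S b * S c * S a * S b * Tw * (S b * S c * S a * S b) * Tw)
  | r21 (a b) (ha : a.val = 0) (hb : b.val = 1) :
      YRel (Tw * (S b * S a * Ew * S a * S b)) (S b * S a * Ew * S a * S b * Tw)

/-- The congruence `≈` on the free monoid `Y*` generated by relations (R11)–(R21). -/
def ycon (n : ℕ) : Con (FreeMonoid (YA n)) := conGen YRel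

/-- The word `s_{i₁}⋯s_{i_k}` over the letters `s`. -/
def sprod {n : ℕ} (L : List (Fin (n - 1))) : FreeMonoid (YA n) := (L.map S).prod

/-- The (0-based) list of indices of `c_r = s_1 s_2 ⋯ s_{r-1}`. -/
def cIdx (n : ℕ) (r : Fin n) : List (Fin (n - 1)) :=
  (List.finRange (n - 1)).filter (fun k => k.val < r.val)

/-- The word `c_r = s_1 s_2 ⋯ s_{r-1}`. -/
def cw {n : ℕ} (r : Fin n) : FreeMonoid (YA n) := sprod (cIdx n r)

/-- The word `c_r⁻¹ = s_{r-1} ⋯ s_2 s_1`. -/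
def cwInv {n : ℕ} (r : Fin n) : FreeMonoid (YA n) := sprod (cIdx n r).reverse

/-- The word `ε_r = c_r⁻¹ e c_r`. -/
def eps {n : ℕ} (r : Fin n) : FreeMonoid (YA n) := cwInv r * Ew * cw r

/-- The word `τ_{ij} = τ_{ji} = c_i⁻¹ c_j⁻¹ t c_j c_i` (for `i < j`), indexed symmetrically. -/
def tauw {n : ℕ} (i j : Fin n) : FreeMonoid (YA n) :=
  cwInv (min i j) * cwInv (max i j) * Tw * cw (max i j) * cw (min i j)

/-- The transposition `σ_k` of `{1,…,n}` interchanging `k` and `k+1`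
(0-based: `sigma n k` swaps the elements of `Fin n` with values `k.val` and `k.val + 1`). -/
def sigma (n : ℕ) (k : Fin (n - 1)) (r : Fin n) : Fin n :=
  if r.val = k.val then ⟨k.val + 1, by have := k.isLt; omega⟩
  else if r.val = k.val + 1 then ⟨k.val, by have := k.isLt; omega⟩
  else r

/-- The iterated conjugate `f (r-1) ⋯ f 1 * f 0 * e * f 0 * f 1 ⋯ f (r-1)`. -/
def iterConj {M : Type*} [Monoid M] (f : ℕ → M) (e : M) : ℕ → M
  | 0 => e
  | r + 1 => f r * iterConj f e r * f r

theorem iterConj_eq_prod {M : Type*} [Monoid M] (f : ℕ → M) (e : M) (r : ℕ) :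
    iterConj f e r =
      ((List.range r).reverse.map f).prod * e * ((List.range r).map f).prod := by
  induction r with
  | zero => simp [iterConj]
  | succ r ih => simp [iterConj, ih, List.range_succ, mul_assoc]

theorem commute_iterConj_of_lt {M : Type*} [Monoid M] {N : ℕ} {f : ℕ → M} {e : M}
    (hcomm : ∀ i j, i + 1 < j → j < N → Commute (f i) (f j))
    (he : ∀ i, 1 ≤ i → i < N → Commute (f i) e) {k r : ℕ} (hk : k < N) (hr : r < k) :
    Commute (f k) (iterConj f e r) := by
  induction r with
  | zero => exact he k hr hk
  | succ r ih =>
    have hf : Commute (f k) (f r) := (hcomm r k hr hk).symm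
    exact (hf.mul_right (ih (by omega))).mul_right hf

theorem commute_iterConj_of_succ_lt {M : Type*} [Monoid M] {N : ℕ} {f : ℕ → M} {e : M}
    (hcomm : ∀ i j, i + 1 < j → j < N → Commute (f i) (f j))
    (hbraid : ∀ i, i + 1 < N → f i * f (i + 1) * f i = f (i + 1) * f i * f (i + 1))
    (he : ∀ i, 1 ≤ i → i < N → Commute (f i) e) {k r : ℕ} (hr : r ≤ N) (hk : k + 1 < r) :
    Commute (f k) (iterConj f e r) := by
  induction r with
  | zero => omega
  | succ r ih =>
    obtain hkr | rfl : k + 1 < r ∨ r = k + 1 := by omega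
    · have hf : Commute (f k) (f r) := hcomm k r hkr hr
      exact (hf.mul_right (ih (by omega) hkr)).mul_right hf
    · have hb := hbraid k hr
      have hc : Commute (f (k + 1)) (iterConj f e k) :=
        commute_iterConj_of_lt hcomm he hr (Nat.lt_succ_self k)
      calc f k * iterConj f e (k + 1 + 1)
          = f k * f (k + 1) * f k * iterConj f e k * f k * f (k + 1) := by
            simp only [iterConj, mul_assoc]
        _ = f (k + 1) * f k * (f (k + 1) * iterConj f e k) * f k * f (k + 1) := by
            rw [hb]; simp only [mul_assoc]
        _ = f (k + 1) * f k * iterConj f e k * (f (k + 1) * f k * f (k + 1)) := by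
            rw [hc.eq]; simp only [mul_assoc]
        _ = iterConj f e (k + 1 + 1) * f k := by
            rw [← hb]; simp only [iterConj, mul_assoc]

theorem map_val_cIdx (n : ℕ) (r : Fin n) : (cIdx n r).map Fin.val = List.range r.val := by
  have hfilter : ∀ m, (List.range m).filter (fun k => k < r.val) = List.range (min m r.val) := by
    intro m
    induction m with
    | zero => simp
    | succ m ih =>
      rw [List.range_succ, List.filter_append, ih]
      by_cases h : m < r.val
      · simp [h, min_eq_left h.le, List.range_succ]
      · simp [h, min_eq_right (not_lt.mp h), min_eq_right (Nat.le_succ_of_le (not_lt.mp h))]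
  have h := hfilter (n - 1)
  rw [← List.map_coe_finRange_eq_range, List.filter_map,
    min_eq_right (Nat.le_sub_one_of_lt r.isLt)] at h
  exact h

/-- The class of `s_{k+1}` modulo `≈`, extended by `1` outside the range of valid indices. -/
def sClass (n k : ℕ) : (ycon n).Quotient :=
  if h : k < n - 1 then ((S ⟨k, h⟩ : FreeMonoid (YA n)) : (ycon n).Quotient) else 1

theorem sClass_val {n : ℕ} (k : Fin (n - 1)) :
    sClass n k.val = ((S k : FreeMonoid (YA n)) : (ycon n).Quotient) := by
  simp [sClass]

theorem coe_eq_of_YRel {n : ℕ} {a b : FreeMonoid (YA n)} (h : YRel a b) :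
    (a : (ycon n).Quotient) = b :=
  (Con.eq _).2 (ConGen.Rel.of _ _ h)

theorem coe_sprod {n : ℕ} (L : List (Fin (n - 1))) :
    ((sprod L : FreeMonoid (YA n)) : (ycon n).Quotient) =
      ((L.map Fin.val).map (sClass n)).prod := by
  induction L with
  | nil => rfl
  | cons a L ih =>
    rw [List.map_cons, List.map_cons, List.prod_cons, ← ih, sClass_val, ← Con.coe_mul]
    rfl

theorem coe_eps {n : ℕ} (r : Fin n) :
    ((eps r : FreeMonoid (YA n)) : (ycon n).Quotient) =
      iterConj (sClass n) ((Ew : FreeMonoid (YA n)) : (ycon n).Quotient) r.val := by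
  rw [iterConj_eq_prod, eps, cwInv, cw, Con.coe_mul, Con.coe_mul, coe_sprod, coe_sprod,
    List.map_reverse, map_val_cIdx]

theorem sClass_mul_self {n k : ℕ} (hk : k < n - 1) : sClass n k * sClass n k = 1 := by
  simpa [sClass, hk] using coe_eq_of_YRel (YRel.r11 (⟨k, hk⟩ : Fin (n - 1)))

theorem commute_sClass {n i j : ℕ} (hij : i + 1 < j) (hj : j < n - 1) :
    Commute (sClass n i) (sClass n j) := by
  have hi : i < n - 1 := by omega
  simpa [sClass, hi, hj, Commute, SemiconjBy] using
    coe_eq_of_YRel (YRel.r12 (⟨i, hi⟩ : Fin (n - 1)) ⟨j, hj⟩ (Or.inl hij))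

theorem sClass_braid {n i : ℕ} (hi : i + 1 < n - 1) :
    sClass n i * sClass n (i + 1) * sClass n i =
      sClass n (i + 1) * sClass n i * sClass n (i + 1) := by
  have hi' : i < n - 1 := by omega
  simpa [sClass, hi, hi'] using
    coe_eq_of_YRel (YRel.r13 (⟨i, hi'⟩ : Fin (n - 1)) ⟨i + 1, hi⟩ (Or.inl rfl))

theorem commute_sClass_Ew {n i : ℕ} (h : 1 ≤ i) (hi : i < n - 1) :
    Commute (sClass n i) ((Ew : FreeMonoid (YA n)) : (ycon n).Quotient) := by
  simpa [sClass, hi, Commute, SemiconjBy] using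
    (coe_eq_of_YRel (YRel.r16 (⟨i, hi⟩ : Fin (n - 1)) h)).symm

/-- Lemma ses: for `1 ≤ r ≤ n` and `1 ≤ k ≤ n-1` (0-based here),
`s_k ε_r s_k ≈ ε_{σ_k(r)}`, where `σ_k` interchanges `k` and `k+1`. -/
theorem stmt10 (n : ℕ) (hn : 2 ≤ n) (r : Fin n) (k : Fin (n - 1)) :
    ycon n (S k * eps r * S k) (eps (sigma n k r)) := by
  rw [← Con.eq, Con.coe_mul, Con.coe_mul, coe_eps, coe_eps, ← sClass_val]
  have hk := k.isLt
  have hr : r.val ≤ n - 1 := Nat.le_sub_one_of_lt r.isLt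
  have hsq := sClass_mul_self hk
  unfold sigma
  split_ifs with h₁ h₂
  · rw [h₁]
    rfl
  · rw [h₂, iterConj, ← mul_assoc, ← mul_assoc, hsq, one_mul, mul_assoc, hsq, mul_one]
  · have hc : Commute (sClass n k.val)
        (iterConj (sClass n) ((Ew : FreeMonoid (YA n)) : (ycon n).Quotient) r.val) := by
      obtain h | h : r.val < k.val ∨ k.val + 1 < r.val := by omega
      · exact commute_iterConj_of_lt (fun _ _ => commute_sClass)
          (fun _ => commute_sClass_Ew) hk h
      · exact commute_iterConj_of_succ_lt (fun _ _ => commute_sClass)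
          (fun _ => sClass_braid) (fun _ => commute_sClass_Ew) hr h
    rw [hc.eq, mul_assoc, hsq, mul_one]
end PaperFormal
end

section
/- Every element of P_n of rank strictly less than n is a (nonempty) product of elements from the set {ē_r : 1 ≤ r ≤ n} ∪ {t̄_{ij} : 1 ≤ i < j ≤ n}. In other words, the singular ideal P_n∖S_n is generated as a semigroup by these elements. -/
namespace PaperFormal


/-- The kernel of a function, as a setoid. -/
def kernelSetoid {α β : Type*} (f : α → β) : Setoid α :=
  ⟨fun x y => f x = f y, ⟨fun _ => rfl, Eq.symm, Eq.trans⟩⟩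

/-- An element of the partition monoid `P_n`: an equivalence relation (set partition) of the
`2n`-element set `{1,…,n} ∪ {1',…,n'}`, modelled as `Fin n ⊕ Fin n` (`Sum.inl` is the
unprimed row, `Sum.inr` the primed row). -/
abbrev PartEq (n : ℕ) := Setoid (Fin n ⊕ Fin n)

/-- Embedding of a two-row set into the three-row set: rows 1 and 2. -/
def emb12 {n : ℕ} : Fin n ⊕ Fin n → Fin n ⊕ (Fin n ⊕ Fin n)
  | Sum.inl a => Sum.inl a
  | Sum.inr a => Sum.inr (Sum.inl a)

/-- Embedding of a two-row set into the three-row set: rows 2 and 3. -/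
def emb23 {n : ℕ} : Fin n ⊕ Fin n → Fin n ⊕ (Fin n ⊕ Fin n)
  | Sum.inl a => Sum.inr (Sum.inl a)
  | Sum.inr a => Sum.inr (Sum.inr a)

/-- Embedding of a two-row set into the three-row set: rows 1 and 3. -/
def emb13 {n : ℕ} : Fin n ⊕ Fin n → Fin n ⊕ (Fin n ⊕ Fin n)
  | Sum.inl a => Sum.inl a
  | Sum.inr a => Sum.inr (Sum.inr a)

/-- The product `αβ` in the partition monoid: take the smallest equivalence on the three-row
set containing the copy of `α` on rows 1–2 and the copy of `β` on rows 2–3, and restrict it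
to rows 1 and 3. -/
def pcompose {n : ℕ} (α β : PartEq n) : PartEq n :=
  ⟨fun x y => Relation.EqvGen (fun u v =>
      (∃ a b, α.r a b ∧ u = emb12 a ∧ v = emb12 b) ∨
      (∃ a b, β.r a b ∧ u = emb23 a ∧ v = emb23 b)) (emb13 x) (emb13 y),
   ⟨fun _ => Relation.EqvGen.refl _,
    fun h => Relation.EqvGen.symm _ _ h,
    fun h h' => Relation.EqvGen.trans _ _ _ h h'⟩⟩

/-- The identity of `P_n`: the partition with blocks `{x, x'}`. -/
def idPart (n : ℕ) : PartEq n :=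
  kernelSetoid (fun x : Fin n ⊕ Fin n => match x with
    | Sum.inl a => a
    | Sum.inr a => a)

/-- The rank of `α ∈ P_n`: the number of blocks of `α` meeting both rows. -/
noncomputable def prank {n : ℕ} (α : PartEq n) : ℕ :=
  Nat.card {q : Quotient α // (∃ a : Fin n, Quotient.mk α (Sum.inl a) = q) ∧
    (∃ b : Fin n, Quotient.mk α (Sum.inr b) = q)}

/-- The partition `ē_r`, with blocks `{r}`, `{r'}` and `{x, x'}` for `x ≠ r`. -/
def ebarP {n : ℕ} (r : Fin n) : PartEq n :=
  kernelSetoid (fun x : Fin n ⊕ Fin n => match x with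
    | Sum.inl a => if a = r then (Sum.inr true : Fin n ⊕ Bool) else Sum.inl a
    | Sum.inr a => if a = r then Sum.inr false else Sum.inl a)

/-- The partition `t̄_{ij}` (for `i ≠ j`), with blocks `{i, j, i', j'}` and `{x, x'}`
for `x ∉ {i, j}`. -/
def tbarP {n : ℕ} (i j : Fin n) : PartEq n :=
  kernelSetoid (fun x : Fin n ⊕ Fin n => match x with
    | Sum.inl a => if a = i ∨ a = j then i else a
    | Sum.inr a => if a = i ∨ a = j then i else a)

/-- Separate the point `p` from its block. -/
def isolate {γ : Type*} (p : γ) (α : Setoid γ) : Setoid γ where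
  r x y := x = y ∨ (x ≠ p ∧ y ≠ p ∧ α x y)
  iseqv := by
    refine ⟨fun _ => Or.inl rfl, ?_, ?_⟩
    · rintro x y (rfl | ⟨hx, hy, h⟩)
      · exact Or.inl rfl
      · exact Or.inr ⟨hy, hx, α.symm h⟩
    · rintro x y z (rfl | ⟨hx, hy, h⟩) (rfl | ⟨hy', hz, h'⟩)
      · exact Or.inl rfl
      · exact Or.inr ⟨hy', hz, h'⟩
      · exact Or.inr ⟨hx, hy, h⟩
      · exact Or.inr ⟨hx, hz, α.trans h h'⟩

/-- Join the blocks of `p` and `q`. -/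
def merge {γ : Type*} (p q : γ) (α : Setoid γ) : Setoid γ where
  r x y := α x y ∨ (α x p ∧ α q y) ∨ (α x q ∧ α p y)
  iseqv := by
    have hs : ∀ {x y}, α x y → α y x := fun h => α.symm h
    have ht : ∀ {x y z}, α x y → α y z → α x z := fun h h' => α.trans h h'
    refine ⟨fun x => Or.inl (α.refl x), ?_, ?_⟩
    · rintro x y (h | ⟨h, h'⟩ | ⟨h, h'⟩)
      · exact Or.inl (hs h)
      · exact Or.inr (Or.inr ⟨hs h', hs h⟩)
      · exact Or.inr (Or.inl ⟨hs h', hs h⟩)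
    · rintro x y z (h | ⟨h, h'⟩ | ⟨h, h'⟩) (k | ⟨k, k'⟩ | ⟨k, k'⟩)
      · exact Or.inl (ht h k)
      · exact Or.inr (Or.inl ⟨ht h k, k'⟩)
      · exact Or.inr (Or.inr ⟨ht h k, k'⟩)
      · exact Or.inr (Or.inl ⟨h, ht h' k⟩)
      · exact Or.inr (Or.inl ⟨h, k'⟩)
      · exact Or.inl (ht h k')
      · exact Or.inr (Or.inr ⟨h, ht h' k⟩)
      · exact Or.inl (ht h k')
      · exact Or.inr (Or.inr ⟨h, k'⟩)

section Moves

variable {γ : Type*}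

theorem isolate_apply {p x y : γ} {α : Setoid γ} :
    isolate p α x y ↔ x = y ∨ (x ≠ p ∧ y ≠ p ∧ α x y) := Iff.rfl

theorem merge_apply {p q x y : γ} {α : Setoid γ} :
    merge p q α x y ↔ α x y ∨ (α x p ∧ α q y) ∨ (α x q ∧ α p y) := Iff.rfl

theorem le_merge (p q : γ) (α : Setoid γ) : α ≤ merge p q α := fun _ _ h => Or.inl h

theorem merge_rel (p q : γ) (α : Setoid γ) : merge p q α p q :=
  Or.inr (Or.inl ⟨α.refl p, α.refl q⟩)

theorem merge_le_iff {p q : γ} {α β : Setoid γ} : merge p q α ≤ β ↔ α ≤ β ∧ β p q := by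
  refine ⟨fun h => ⟨(le_merge p q α).trans h, h (merge_rel p q α)⟩, ?_⟩
  rintro ⟨h, hpq⟩ x y (h1 | ⟨h1, h2⟩ | ⟨h1, h2⟩)
  · exact h h1
  · exact β.trans (h h1) (β.trans hpq (h h2))
  · exact β.trans (h h1) (β.trans (β.symm hpq) (h h2))

theorem merge_self (p : γ) (α : Setoid γ) : merge p p α = α :=
  le_antisymm (merge_le_iff.2 ⟨le_rfl, α.refl p⟩) (le_merge p p α)

theorem merge_symm (p q : γ) (α : Setoid γ) : merge p q α = merge q p α :=
  le_antisymm (merge_le_iff.2 ⟨le_merge _ _ _, Setoid.symm' _ (merge_rel q p α)⟩)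
    (merge_le_iff.2 ⟨le_merge _ _ _, Setoid.symm' _ (merge_rel p q α)⟩)

theorem merge_merge_comm (p q r s : γ) (α : Setoid γ) :
    merge p q (merge r s α) = merge r s (merge p q α) :=
  eq_of_forall_ge_iff fun β => by simp only [merge_le_iff]; tauto

theorem merge_isolate_comm {p q r : γ} (hp : p ≠ r) (hq : q ≠ r) (α : Setoid γ) :
    merge p q (isolate r α) = isolate r (merge p q α) := by
  apply le_antisymm
  · refine merge_le_iff.2 ⟨?_, Or.inr ⟨hp, hq, merge_rel p q α⟩⟩
    rintro x y (h | ⟨hx, hy, h⟩)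
    · exact Or.inl h
    · exact Or.inr ⟨hx, hy, le_merge _ _ _ h⟩
  · rintro x y (rfl | ⟨hx, hy, h | ⟨h, h'⟩ | ⟨h, h'⟩⟩)
    · exact Setoid.refl' _ _
    · exact le_merge _ _ _ (Or.inr ⟨hx, hy, h⟩)
    · exact Or.inr (Or.inl ⟨Or.inr ⟨hx, hp, h⟩, Or.inr ⟨hq, hy, h'⟩⟩)
    · exact Or.inr (Or.inr ⟨Or.inr ⟨hx, hq, h⟩, Or.inr ⟨hp, hy, h'⟩⟩)

end Moves

section Generation

variable {n : ℕ}

theorem eq_of_pcompose {γ : Type*} {α β : PartEq n} (f : Fin n ⊕ (Fin n ⊕ Fin n) → γ)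
    (hα : ∀ a b, α a b → f (emb12 a) = f (emb12 b))
    (hβ : ∀ a b, β a b → f (emb23 a) = f (emb23 b)) {x y : Fin n ⊕ Fin n}
    (h : pcompose α β x y) : f (emb13 x) = f (emb13 y) := by
  have key : ∀ u v, Relation.EqvGen (fun u v =>
      (∃ a b, α.r a b ∧ u = emb12 a ∧ v = emb12 b) ∨
      (∃ a b, β.r a b ∧ u = emb23 a ∧ v = emb23 b)) u v → f u = f v := by
    intro u v h
    induction h with
    | rel u v h =>
      rcases h with ⟨a, b, h, rfl, rfl⟩ | ⟨a, b, h, rfl, rfl⟩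
      · exact hα a b h
      · exact hβ a b h
    | refl => rfl
    | symm _ _ _ ih => exact ih.symm
    | trans _ _ _ _ _ ih ih' => exact ih.trans ih'
  exact key _ _ h

theorem pcompose_ebarP (α : PartEq n) (r : Fin n) :
    pcompose α (ebarP r) = isolate (Sum.inr r) α := by
  ext x y
  constructor
  · intro h
    have := eq_of_pcompose (fun u => match u with
      | Sum.inl a => some (Quotient.mk α (Sum.inl a))
      | Sum.inr (Sum.inl a) => some (Quotient.mk α (Sum.inr a))
      | Sum.inr (Sum.inr a) => if a = r then none else some (Quotient.mk α (Sum.inr a)))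
      ?_ ?_ h
    · rw [isolate_apply]
      have hexact : ∀ {u v}, Quotient.mk α u = Quotient.mk α v → α u v := Quotient.exact
      rcases x with x | x <;> rcases y with y | y <;> simp only [emb13] at this <;>
        grind
    · rintro (a | a) (b | b) h <;> simpa [emb12, Quotient.eq] using h
    · rintro (a | a) (b | b) h <;> change ite _ _ _ = ite _ _ _ at h <;>
        simp only [emb23] <;> grind
  · rintro (rfl | ⟨hx, hy, h⟩)
    · exact Setoid.refl' _ _
    · have link : ∀ z : Fin n ⊕ Fin n, z ≠ Sum.inr r → Relation.EqvGen (fun u v =>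
          (∃ a b, α.r a b ∧ u = emb12 a ∧ v = emb12 b) ∨
          (∃ a b, (ebarP r).r a b ∧ u = emb23 a ∧ v = emb23 b)) (emb13 z) (emb12 z) := by
        rintro (z | z) hz
        · exact .refl _
        · refine .rel _ _ (Or.inr ⟨Sum.inr z, Sum.inl z, ?_, rfl, rfl⟩)
          have : z ≠ r := fun h => hz (h ▸ rfl)
          change ite _ _ _ = ite _ _ _
          simp [this]
      exact .trans _ _ _ (link x hx) (.trans _ _ _
        (.rel _ _ (Or.inl ⟨x, y, h, rfl, rfl⟩)) (.symm _ _ (link y hy)))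

theorem pcompose_tbarP (α : PartEq n) (i j : Fin n) :
    pcompose α (tbarP i j) = merge (Sum.inr i) (Sum.inr j) α := by
  apply le_antisymm
  · intro x y h
    have hij : Quotient.mk (merge (Sum.inr i) (Sum.inr j) α) (Sum.inr i) =
      Quotient.mk (merge (Sum.inr i) (Sum.inr j) α) (Sum.inr j) :=
      Quotient.sound (merge_rel _ _ _)
    have := eq_of_pcompose (fun u => Quotient.mk (merge (Sum.inr i) (Sum.inr j) α) (match u with
      | Sum.inl a => Sum.inl a
      | Sum.inr (Sum.inl a) => Sum.inr a
      | Sum.inr (Sum.inr a) => Sum.inr a)) ?_ ?_ h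
    · rcases x with x | x <;> rcases y with y | y <;> exact Quotient.exact this
    · rintro (a | a) (b | b) h <;> exact Quotient.sound (le_merge _ _ _ h)
    · rintro (a | a) (b | b) h <;> change ite _ _ _ = ite _ _ _ at h <;>
        simp only [emb23] <;> split_ifs at h <;> grind
  · have link : ∀ z : Fin n ⊕ Fin n, Relation.EqvGen (fun u v =>
        (∃ a b, α.r a b ∧ u = emb12 a ∧ v = emb12 b) ∨
        (∃ a b, (tbarP i j).r a b ∧ u = emb23 a ∧ v = emb23 b)) (emb13 z) (emb12 z) := by
      rintro (z | z)
      · exact .refl _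
      · exact .rel _ _ (Or.inr ⟨Sum.inr z, Sum.inl z, rfl, rfl, rfl⟩)
    refine merge_le_iff.2 ⟨fun x y h => ?_, ?_⟩
    · exact .trans _ _ _ (link x) (.trans _ _ _
        (.rel _ _ (Or.inl ⟨x, y, h, rfl, rfl⟩)) (.symm _ _ (link y)))
    · refine .rel _ _ (Or.inr ⟨Sum.inr i, Sum.inr j, ?_, rfl, rfl⟩)
      change ite _ _ _ = ite _ _ _
      simp

/-- The generators `ē_r` and `t̄_{ij}` with `i < j`. -/
def IsGenerator (x : PartEq n) : Prop :=
  (∃ r, x = ebarP r) ∨ (∃ i j : Fin n, i < j ∧ x = tbarP i j)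

/-- Nonempty products of generators. -/
inductive IsProduct : PartEq n → Prop
  | gen {g : PartEq n} : IsGenerator g → IsProduct g
  | mul {α g : PartEq n} : IsProduct α → IsGenerator g → IsProduct (pcompose α g)

theorem IsProduct.exists_list {α : PartEq n} (h : IsProduct α) :
    ∃ (a : PartEq n) (L : List (PartEq n)),
      IsGenerator a ∧ (∀ x ∈ L, IsGenerator x) ∧ α = L.foldl pcompose a := by
  induction h with
  | gen hg => exact ⟨_, [], hg, by simp, rfl⟩
  | @mul α g _ hg ih =>
    obtain ⟨a, L, ha, hL, rfl⟩ := ih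
    refine ⟨a, L ++ [g], ha, fun x hx => ?_, by simp⟩
    rcases List.mem_append.1 hx with hx | hx
    · exact hL x hx
    · rwa [List.mem_singleton.1 hx]

theorem IsProduct.isolate_inr {α : PartEq n} (h : IsProduct α) (r : Fin n) :
    IsProduct (isolate (Sum.inr r) α) :=
  pcompose_ebarP α r ▸ h.mul (Or.inl ⟨r, rfl⟩)

theorem IsProduct.merge_inr {α : PartEq n} (h : IsProduct α) (i j : Fin n) :
    IsProduct (merge (Sum.inr i) (Sum.inr j) α) := by
  rcases lt_trichotomy i j with hij | rfl | hij
  · exact pcompose_tbarP α i j ▸ h.mul (Or.inr ⟨i, j, hij, rfl⟩)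
  · rwa [merge_self]
  · rw [merge_symm]
    exact pcompose_tbarP α j i ▸ h.mul (Or.inr ⟨j, i, hij, rfl⟩)

/-- The column of a point of the two-row set. -/
def column : Fin n ⊕ Fin n → Fin n := Sum.elim id id

theorem idPart_apply {x y : Fin n ⊕ Fin n} : idPart n x y ↔ column x = column y := by
  rcases x with x | x <;> rcases y with y | y <;> rfl

theorem ebarP_eq (r : Fin n) : ebarP r = isolate (Sum.inr r) (idPart n) := by
  ext x y
  rw [isolate_apply, idPart_apply]
  rcases x with x | x <;> rcases y with y | y <;> simp only [column, Sum.elim_inl, Sum.elim_inr] <;>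
    change ite _ _ _ = ite _ _ _ ↔ _ <;> split_ifs <;> simp_all <;> grind

theorem tbarP_eq_merge_inr (i j : Fin n) :
    tbarP i j = merge (Sum.inr i) (Sum.inr j) (idPart n) := by
  ext x y
  simp only [merge_apply, idPart_apply]
  rcases x with x | x <;> rcases y with y | y <;> simp only [column, Sum.elim_inl, Sum.elim_inr] <;>
    change ite _ _ _ = ite _ _ _ ↔ _ <;> split_ifs <;> grind

theorem tbarP_eq_merge_inl (i j : Fin n) :
    tbarP i j = merge (Sum.inl i) (Sum.inl j) (idPart n) := by
  ext x y
  rw [tbarP_eq_merge_inr]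
  simp only [merge_apply, idPart_apply, column, Sum.elim_inl, Sum.elim_inr]

theorem IsProduct.merge_inl_of_lt {α : PartEq n} (h : IsProduct α) {i j : Fin n} (hij : i < j) :
    IsProduct (merge (Sum.inl i) (Sum.inl j) α) := by
  have ht : IsProduct (tbarP i j) := .gen (Or.inr ⟨i, j, hij, rfl⟩)
  induction h with
  | gen hg =>
    rcases hg with ⟨r, rfl⟩ | ⟨k, l, hkl, rfl⟩
    · rw [ebarP_eq, merge_isolate_comm (by simp) (by simp), ← tbarP_eq_merge_inl]
      exact ht.isolate_inr r
    · rw [tbarP_eq_merge_inr k l, merge_merge_comm, ← tbarP_eq_merge_inl]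
      exact ht.merge_inr k l
  | mul _ hg ih =>
    rcases hg with ⟨r, rfl⟩ | ⟨k, l, hkl, rfl⟩
    · rw [pcompose_ebarP, merge_isolate_comm (by simp) (by simp)]
      exact ih.isolate_inr r
    · rw [pcompose_tbarP, merge_merge_comm]
      exact ih.merge_inr k l

theorem IsProduct.merge_inl {α : PartEq n} (h : IsProduct α) (i j : Fin n) :
    IsProduct (merge (Sum.inl i) (Sum.inl j) α) := by
  rcases lt_trichotomy i j with hij | rfl | hij
  · exact h.merge_inl_of_lt hij
  · rwa [merge_self]
  · rw [merge_symm]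
    exact h.merge_inl_of_lt hij

/-- A product of generators can be coarsened within each row. -/
theorem IsProduct.of_le {β α : PartEq n} (hβ : IsProduct β) (hle : β ≤ α)
    (hlink : ∀ a b, α (Sum.inl a) (Sum.inr b) →
      ∃ a' b', α (Sum.inl a) (Sum.inl a') ∧ β (Sum.inl a') (Sum.inr b')) :
    IsProduct α := by
  have : Finite (PartEq n) :=
    Finite.of_injective (fun α : PartEq n => fun x y => α x y) fun α β h =>
      Setoid.ext fun x y => iff_of_eq (congrFun (congrFun h x) y)
  obtain ⟨δ, hδ⟩ := (Set.toFinite {δ : PartEq n | IsProduct δ ∧ β ≤ δ ∧ δ ≤ α}).exists_maximal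
    ⟨β, hβ, le_rfl, hle⟩
  obtain ⟨⟨hp, hβδ, hδα⟩, hmax⟩ := hδ
  have hinl : ∀ i j, α (Sum.inl i) (Sum.inl j) → δ (Sum.inl i) (Sum.inl j) := fun i j h =>
    hmax ⟨hp.merge_inl i j, hβδ.trans (le_merge _ _ _), merge_le_iff.2 ⟨hδα, h⟩⟩
      (le_merge _ _ _) (merge_rel _ _ _)
  have hinr : ∀ i j, α (Sum.inr i) (Sum.inr j) → δ (Sum.inr i) (Sum.inr j) := fun i j h =>
    hmax ⟨hp.merge_inr i j, hβδ.trans (le_merge _ _ _), merge_le_iff.2 ⟨hδα, h⟩⟩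
      (le_merge _ _ _) (merge_rel _ _ _)
  have hlr : ∀ a b, α (Sum.inl a) (Sum.inr b) → δ (Sum.inl a) (Sum.inr b) := by
    intro a b h
    obtain ⟨a', b', h1, h2⟩ := hlink a b h
    exact δ.trans (hinl _ _ h1) (δ.trans (hβδ h2)
      (hinr _ _ (α.trans (α.symm (hle h2)) (α.trans (α.symm h1) h))))
  have : δ = α := by
    refine le_antisymm hδα ?_
    rintro (a | a) (b | b) h
    · exact hinl a b h
    · exact hlr a b h
    · exact δ.symm (hlr b a (α.symm h))
    · exact hinr a b h
  exact this ▸ hp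

/-- Renumber the lower row. -/
def renumber (σ : Equiv.Perm (Fin n)) (α : PartEq n) : PartEq n := α.comap (Sum.map id σ)

theorem renumber_apply {σ : Equiv.Perm (Fin n)} {α : PartEq n} {x y : Fin n ⊕ Fin n} :
    renumber σ α x y ↔ α (Sum.map id σ x) (Sum.map id σ y) := Iff.rfl

theorem renumber_refl (α : PartEq n) : renumber (Equiv.refl _) α = α := by
  ext x y
  rcases x with x | x <;> rcases y with y | y <;> rfl

/-- The point `j'` forms a block on its own. -/
def IsHole (α : PartEq n) (j : Fin n) : Prop := ∀ x, α x (Sum.inr j) → x = Sum.inr j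

theorem IsHole.renumber {α : PartEq n} {j : Fin n} (h : IsHole α j) (σ : Equiv.Perm (Fin n)) :
    IsHole (renumber σ α) (σ.symm j) := by
  intro x hx
  rw [renumber_apply] at hx
  simp only [Sum.map_inr, Equiv.apply_symm_apply] at hx
  have := h _ hx
  rcases x with x | x
  · simp at this
  · simp only [Sum.map_inr, Sum.inr.injEq] at this
    simp [← this]

theorem IsProduct.renumber_swap_of_isHole {α : PartEq n} (h : IsProduct α) {j : Fin n}
    (hj : IsHole α j) (i : Fin n) : IsProduct (renumber (Equiv.swap i j) α) := by
  by_cases hij : i = j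
  · subst hij
    rwa [Equiv.swap_self, renumber_refl]
  have hmap : ∀ x : Fin n ⊕ Fin n, Sum.map id (Equiv.swap i j) x =
      if x = Sum.inr i then Sum.inr j else if x = Sum.inr j then Sum.inr i else x := by
    rintro (x | x) <;> simp [Equiv.swap_apply_def]
    split_ifs <;> rfl
  have key : renumber (Equiv.swap i j) α =
      isolate (Sum.inr i) (merge (Sum.inr i) (Sum.inr j) α) := by
    have hs : ∀ {x y}, α x y → α y x := fun h => α.symm h
    have hj1 : ∀ x, α x (Sum.inr j) ↔ x = Sum.inr j :=
      fun x => ⟨hj x, fun h => h ▸ α.refl x⟩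
    have hj2 : ∀ x, α (Sum.inr j) x ↔ x = Sum.inr j :=
      fun x => ⟨fun h => hj x (hs h), fun h => h ▸ α.refl x⟩
    have hr : ∀ x, α x x := α.refl
    have hne : (Sum.inr i : Fin n ⊕ Fin n) ≠ Sum.inr j := by simpa using hij
    ext x y
    rw [renumber_apply, hmap, hmap, isolate_apply, merge_apply, hj1, hj2]
    generalize (Sum.inr i : Fin n ⊕ Fin n) = p at *
    generalize (Sum.inr j : Fin n ⊕ Fin n) = q at *
    by_cases hxp : x = p <;> by_cases hxq : x = q <;> by_cases hyp : y = p <;>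
      by_cases hyq : y = q <;> by_cases hxy : x = y <;> grind
  rw [key]
  exact (h.merge_inr i j).isolate_inr i

theorem renumber_mul (σ τ : Equiv.Perm (Fin n)) (α : PartEq n) :
    renumber (σ * τ) α = renumber τ (renumber σ α) := by
  ext x y
  simp only [renumber_apply]
  rcases x with x | x <;> rcases y with y | y <;> rfl

theorem IsProduct.renumber_swap {α : PartEq n} (h : IsProduct α) {k : Fin n}
    (hk : IsHole α k) (i j : Fin n) : IsProduct (renumber (Equiv.swap i j) α) := by
  by_cases hkj : k = j
  · exact h.renumber_swap_of_isHole (hkj ▸ hk) i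
  by_cases hki : k = i
  · rw [Equiv.swap_comm]
    exact h.renumber_swap_of_isHole (hki ▸ hk) j
  by_cases hij : i = j
  · subst hij
    rwa [Equiv.swap_self, renumber_refl]
  have h1 := h.renumber_swap_of_isHole hk i
  have k1 : IsHole (renumber (Equiv.swap i k) α) i := by simpa using hk.renumber (Equiv.swap i k)
  have h2 := h1.renumber_swap_of_isHole k1 j
  have k2 : IsHole (renumber (Equiv.swap j i) (renumber (Equiv.swap i k) α)) j := by
    simpa using k1.renumber (Equiv.swap j i)
  have h3 := h2.renumber_swap_of_isHole k2 k
  rw [← renumber_mul, ← renumber_mul] at h3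
  convert h3 using 2
  ext x
  simp only [Equiv.Perm.mul_apply, Equiv.swap_apply_def]
  grind

theorem IsProduct.renumber {α : PartEq n} (h : IsProduct α) {k : Fin n}
    (hk : IsHole α k) (σ : Equiv.Perm (Fin n)) : IsProduct (renumber σ α) := by
  induction σ using Equiv.Perm.swap_induction_on generalizing α k with
  | one => rwa [Equiv.Perm.one_def, renumber_refl]
  | swap_mul τ i j _ ih =>
    rw [renumber_mul]
    exact ih (h.renumber_swap hk i j) (hk.renumber _)

/-- The partial identity: `x` is joined to `x'` unless `x ∈ B`. -/
def partialId (B : Finset (Fin n)) : PartEq n where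
  r x y := x = y ∨ (column x = column y ∧ column x ∉ B)
  iseqv := ⟨fun _ => Or.inl rfl, by grind, by grind⟩

theorem partialId_apply {B : Finset (Fin n)} {x y : Fin n ⊕ Fin n} :
    partialId B x y ↔ x = y ∨ (column x = column y ∧ column x ∉ B) := Iff.rfl

theorem partialId_empty : partialId (∅ : Finset (Fin n)) = idPart n := by
  ext x y
  rw [partialId_apply, idPart_apply]
  grind

theorem partialId_insert (r : Fin n) (B : Finset (Fin n)) :
    partialId (insert r B) = isolate (Sum.inr r) (partialId B) := by
  ext x y
  rw [isolate_apply, partialId_apply, partialId_apply]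
  rcases x with x | x <;> rcases y with y | y <;> simp [column] <;> grind

theorem isProduct_partialId {B : Finset (Fin n)} (hB : B.Nonempty) :
    IsProduct (partialId B) := by
  induction hB using Finset.Nonempty.cons_induction with
  | singleton r =>
    rw [← insert_empty_eq, partialId_insert, partialId_empty, ← ebarP_eq]
    exact .gen (Or.inl ⟨r, rfl⟩)
  | cons r B _ _ ih =>
    rw [Finset.cons_eq_insert, partialId_insert]
    exact ih.isolate_inr r

theorem isHole_partialId {B : Finset (Fin n)} {r : Fin n} (hr : r ∈ B) :
    IsHole (partialId B) r := by
  rintro x (h | ⟨h, h'⟩)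
  · exact h
  · exact absurd (h ▸ hr) h'

theorem isProduct_of_prank_lt {α : PartEq n} (hα : prank α < n) : IsProduct α := by
  classical
  let T := {q : Quotient α // (∃ a : Fin n, Quotient.mk α (Sum.inl a) = q) ∧
    (∃ b : Fin n, Quotient.mk α (Sum.inr b) = q)}
  choose t ht using fun q : T => q.2.1
  choose b hb using fun q : T => q.2.2
  have ht_inj : Function.Injective t := fun p q h => Subtype.ext (by rw [← ht p, ← ht q, h])
  have hb_inj : Function.Injective b := fun p q h => Subtype.ext (by rw [← hb p, ← hb q, h])
  obtain ⟨σ, hσ⟩ := Equiv.Perm.exists_extending_pair b t hb_inj ht_inj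
  let B : Finset (Fin n) := Finset.univ.filter fun x => x ∉ Set.range t
  have hB : B.Nonempty := by
    by_contra hB
    have hsurj : Function.Surjective t := by
      intro x
      by_contra hx
      exact hB ⟨x, by simpa [B] using hx⟩
    have hle := Nat.card_le_card_of_surjective t hsurj
    rw [Nat.card_eq_fintype_card (α := Fin n), Fintype.card_fin] at hle
    exact absurd hα (not_lt.2 hle)
  obtain ⟨r, hr⟩ := hB
  refine ((isProduct_partialId ⟨r, hr⟩).renumber (isHole_partialId hr) σ).of_le ?_ ?_
  · have hcol : ∀ q x, column (Sum.map id σ x) = t q → Quotient.mk α x = q.1 := by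
      rintro q (x | x) h
      · exact (congrArg _ (congrArg _ h)).trans (ht q)
      · exact (congrArg _ (congrArg _ (σ.injective (h.trans (hσ q).symm)))).trans (hb q)
    rintro x y (h | ⟨h, h'⟩)
    · rw [Function.Injective.sumMap Function.injective_id σ.injective h]
    · obtain ⟨q, hq⟩ : column (Sum.map id σ x) ∈ Set.range t := by simpa [B] using h'
      exact Quotient.exact ((hcol q x hq.symm).trans (hcol q y (h.symm.trans hq.symm)).symm)
  · intro a c h
    let q : T := ⟨Quotient.mk α (Sum.inl a), ⟨a, rfl⟩, ⟨c, (Quotient.sound h).symm⟩⟩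
    refine ⟨t q, b q, Quotient.exact (ht q).symm, ?_⟩
    rw [renumber_apply, partialId_apply]
    right
    simp [column, hσ, B]

end Generation

/-- every element of `P_n` of rank `< n` is a nonempty product of elements
from `{ē_r : 1 ≤ r ≤ n} ∪ {t̄_{ij} : 1 ≤ i < j ≤ n}`; i.e. the singular ideal `P_n∖S_n` is
generated as a semigroup by these elements. -/
theorem stmt17 (n : ℕ) (hn : 2 ≤ n) (α : PartEq n) (hα : prank α < n) :
    ∃ (a : PartEq n) (L : List (PartEq n)),
      ((∃ r, a = ebarP r) ∨ (∃ i j : Fin n, i < j ∧ a = tbarP i j)) ∧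
      (∀ x ∈ L, (∃ r, x = ebarP r) ∨ (∃ i j : Fin n, i < j ∧ x = tbarP i j)) ∧
      α = L.foldl pcompose a := by
  exact (isProduct_of_prank_lt hα).exists_list
end PaperFormal
end
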